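/- arXiv:2601.02222 — 2 statements merged into one kernel-verified Lean document; each statement's English description precedes it below -/
import Mathlib

section
/- There exist constants C̃ > 0 and C > 0, depending only on d, the coefficients (v̂_k) and w, with the following property: if a < b, the open interval (a,b) is disjoint from σ_α, |α − α'| < C̃, and a + C·|α − α'|^{1/2} < b − C·|α − α'|^{1/2}, then the open interval (a + C·|α − α'|^{1/2}, b − C·|α − α'|^{1/2}) is disjoint from σ_{α'}. -/
open scoped BigOperators

section Hilbert

variable {E : Type*} [NormedAddCommGroup E] [InnerProductSpace ℂ E]

lemma ContinuousLinearMap.sub_algebraMap_apply (T : E →L[ℂ] E) (x : ℂ) (u : E) :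
    (T - algebraMap ℂ (E →L[ℂ] E) x) u = T u - x • u := by
  simp [Algebra.algebraMap_eq_smul_one]

variable [CompleteSpace E]

lemma IsSelfAdjoint.isUnit_of_mul_norm_le {T : E →L[ℂ] E} (hT : IsSelfAdjoint T) {c : ℝ}
    (hc : 0 < c) (h : ∀ u, c * ‖u‖ ≤ ‖T u‖) : IsUnit T := by
  rw [ContinuousLinearMap.isUnit_iff_bijective,
    ContinuousLinearMap.bijective_iff_dense_range_and_antilipschitz]
  refine ⟨?_, ⟨Real.toNNReal c⁻¹, T.antilipschitz_of_bound fun u => ?_⟩⟩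
  · rw [Submodule.topologicalClosure_eq_top_iff, T.orthogonal_range, Submodule.eq_bot_iff]
    intro u hu
    have hu' : T u = 0 := by
      rw [ContinuousLinearMap.isSelfAdjoint_iff'] at hT
      rwa [hT] at hu
    have := h u
    rw [hu', norm_zero] at this
    exact norm_eq_zero.mp (by nlinarith [norm_nonneg u])
  · rw [Real.coe_toNNReal _ (inv_nonneg.mpr hc.le), inv_mul_eq_div, le_div_iff₀ hc, mul_comm]
    exact h u

lemma IsSelfAdjoint.sub_algebraMap_ofReal {T : E →L[ℂ] E} (hT : IsSelfAdjoint T) (x : ℝ) :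
    IsSelfAdjoint (T - algebraMap ℂ (E →L[ℂ] E) x) :=
  hT.sub (IsSelfAdjoint.algebraMap _ (Complex.conj_ofReal x))

lemma IsSelfAdjoint.mul_norm_le_norm_of_spectrum {T : E →L[ℂ] E} (hT : IsSelfAdjoint T) {r : ℝ}
    (hr : 0 < r) (h : ∀ z ∈ spectrum ℂ T, r ≤ ‖z‖) (u : E) : r * ‖u‖ ≤ ‖T u‖ := by
  have hunit : IsUnit T := by
    by_contra hT0
    have := h 0 (spectrum.zero_mem ℂ hT0)
    simp at this
    linarith
  obtain ⟨S, rfl⟩ := hunit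
  have hS : IsSelfAdjoint (↑S⁻¹ : E →L[ℂ] E) := by
    have h1 : star S = S := Units.ext hT
    have h2 : star S⁻¹ = S⁻¹ := by rw [star_inv, h1]
    exact congrArg Units.val h2
  have hnorm : ‖(↑S⁻¹ : E →L[ℂ] E)‖ ≤ r⁻¹ := by
    have h1 : spectralRadius ℂ (↑S⁻¹ : E →L[ℂ] E) ≤ ENNReal.ofReal r⁻¹ := by
      refine iSup₂_le fun z hz => ?_
      have hz' := h _ (spectrum.inv₀_mem_iff.mpr hz)
      rw [norm_inv] at hz'
      rw [← enorm_eq_nnnorm, ← ofReal_norm]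
      refine ENNReal.ofReal_le_ofReal ?_
      exact (le_inv_comm₀ hr (inv_pos.mp (hr.trans_le hz'))).mp hz'
    rw [hS.spectralRadius_eq_nnnorm] at h1
    have h2 : ENNReal.ofReal ‖(↑S⁻¹ : E →L[ℂ] E)‖ ≤ ENNReal.ofReal r⁻¹ := by
      rwa [ofReal_norm]
    exact (ENNReal.ofReal_le_ofReal_iff (inv_nonneg.mpr hr.le)).mp h2
  have hu : (↑S⁻¹ : E →L[ℂ] E) ((S : E →L[ℂ] E) u) = u := by
    rw [← mul_apply_eq_comp, Units.inv_mul, one_apply_eq_self]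
  have := (↑S⁻¹ : E →L[ℂ] E).le_of_opNorm_le hnorm ((S : E →L[ℂ] E) u)
  rw [hu, inv_mul_eq_div, le_div_iff₀ hr] at this
  linarith

lemma IsSelfAdjoint.mul_norm_le_norm_sub_of_spectrum {T : E →L[ℂ] E} (hT : IsSelfAdjoint T)
    {x r : ℝ} (hr : 0 < r) (h : ∀ y : ℝ, |y| < r → ((x + y : ℝ) : ℂ) ∉ spectrum ℂ T) (u : E) :
    r * ‖u‖ ≤ ‖T u - (x : ℂ) • u‖ := by
  rw [← ContinuousLinearMap.sub_algebraMap_apply]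
  refine (hT.sub_algebraMap_ofReal x).mul_norm_le_norm_of_spectrum hr (fun z hz => ?_) u
  have hzre := (hT.sub_algebraMap_ofReal x).mem_spectrum_eq_re hz
  rw [hzre, sub_eq_neg_add, ← spectrum.add_mem_iff] at hz
  rw [hzre, Complex.norm_real, Real.norm_eq_abs]
  by_contra! hlt
  refine h z.re hlt ?_
  rwa [Complex.ofReal_add, add_comm]

lemma IsSelfAdjoint.notMem_spectrum_of_mul_norm_le {T : E →L[ℂ] E} (hT : IsSelfAdjoint T)
    {x c : ℝ} (hc : 0 < c) (h : ∀ u, c * ‖u‖ ≤ ‖T u - (x : ℂ) • u‖) :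
    (x : ℂ) ∉ spectrum ℂ T := by
  have hunit := (hT.sub_algebraMap_ofReal x).isUnit_of_mul_norm_le hc fun u => by
    rw [ContinuousLinearMap.sub_algebraMap_apply]
    exact h u
  rw [spectrum.notMem_iff, ← neg_sub]
  exact hunit.neg

end Hilbert

lemma Function.Periodic.exists_lipschitz {w : ℝ → ℝ} (hw : ContDiff ℝ 1 w) {c : ℝ}
    (hwper : Function.Periodic w c) (hc : c ≠ 0) :
    ∃ l : ℝ, 0 ≤ l ∧ ∀ x y, |w x - w y| ≤ l * |x - y| := by
  have hper : Function.Periodic (deriv w) c := fun x => by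
    rw [← deriv_comp_add_const, hwper.funext]
  have hcont : Continuous (deriv w) := hw.continuous_deriv le_rfl
  obtain ⟨l, hl⟩ := (hper.isBounded_of_continuous hc hcont).exists_norm_le
  refine ⟨l, (norm_nonneg _).trans (hl _ ⟨0, rfl⟩), fun x y => ?_⟩
  exact Convex.norm_image_sub_le_of_norm_deriv_le (s := Set.univ) (f := w)
    (fun z _ => (hw.differentiable one_ne_zero) z) (fun z _ => hl _ ⟨z, rfl⟩) convex_univ
    (Set.mem_univ y) (Set.mem_univ x)

/-- The tent function on `ℤ` of height `1` and slope `δ`. -/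
def tent (δ : ℝ) (m : ℤ) : ℝ := max 0 (1 - δ * |(m : ℝ)|)

lemma tent_nonneg (δ : ℝ) (m : ℤ) : 0 ≤ tent δ m := le_max_left _ _

lemma tent_le_one {δ : ℝ} (hδ : 0 ≤ δ) (m : ℤ) : tent δ m ≤ 1 :=
  max_le zero_le_one (by have := mul_nonneg hδ (abs_nonneg (m : ℝ)); linarith)

lemma tent_eq_zero {δ : ℝ} {m : ℤ} (h : 1 ≤ δ * |(m : ℝ)|) : tent δ m = 0 :=
  max_eq_left (by linarith)

lemma mul_abs_mul_tent_le (δ : ℝ) (m : ℤ) : δ * |(m : ℝ)| * tent δ m ≤ tent δ m := by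
  rcases le_total 1 (δ * |(m : ℝ)|) with h | h
  · simp [tent_eq_zero h]
  · exact mul_le_of_le_one_left (tent_nonneg δ m) h

lemma abs_tent_sub_le {δ : ℝ} (hδ : 0 ≤ δ) (m k : ℤ) :
    |tent δ (m - k) - tent δ m| ≤ δ * |(k : ℝ)| := by
  unfold tent
  have h1 := abs_max_sub_max_le_abs (1 - δ * |((m - k : ℤ) : ℝ)|) (1 - δ * |(m : ℝ)|) 0
  rw [max_comm 0, max_comm 0]
  refine h1.trans ?_
  have h2 : (1 - δ * |((m - k : ℤ) : ℝ)|) - (1 - δ * |(m : ℝ)|)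
      = δ * (|(m : ℝ)| - |((m - k : ℤ) : ℝ)|) := by ring
  rw [h2, abs_mul, abs_of_nonneg hδ]
  refine mul_le_mul_of_nonneg_left ?_ hδ
  refine (abs_abs_sub_abs_le _ _).trans (le_of_eq ?_)
  push_cast
  congr 1
  ring

/-- Radius of the interval on which `tent δ` is at least `1 / 2`. -/
noncomputable def tentRadius (δ : ℝ) : ℕ := ⌊1 / (2 * δ)⌋₊

lemma half_le_tent {δ : ℝ} (hδ : 0 < δ) {m : ℤ}
    (hm : m ∈ Finset.Icc (-(tentRadius δ : ℤ)) (tentRadius δ)) : 1 / 2 ≤ tent δ m := by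
  refine le_trans ?_ (le_max_right _ _)
  have h1 : (tentRadius δ : ℝ) ≤ 1 / (2 * δ) := Nat.floor_le (by positivity)
  have h2 : |m| ≤ (tentRadius δ : ℤ) := abs_le.mpr (Finset.mem_Icc.mp hm)
  have h3 : |(m : ℝ)| ≤ tentRadius δ := by exact_mod_cast h2
  have h4 := h3.trans h1
  rw [le_div_iff₀ (by positivity)] at h4
  linarith

lemma tent_eq_zero_of_notMem {δ : ℝ} (hδ : 0 < δ) {m : ℤ}
    (hm : m ∉ Finset.Icc (-(2 * tentRadius δ + 1 : ℤ)) (2 * tentRadius δ + 1)) :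
    tent δ m = 0 := by
  apply tent_eq_zero
  have h1 : 1 / (2 * δ) < tentRadius δ + 1 := Nat.lt_floor_add_one _
  have h2 : 2 * (tentRadius δ : ℤ) + 2 ≤ |m| := by
    rw [Finset.mem_Icc, ← abs_le] at hm
    omega
  have h3 : 2 * (tentRadius δ : ℝ) + 2 ≤ |(m : ℝ)| := by exact_mod_cast h2
  rw [div_lt_iff₀ (by positivity)] at h1
  nlinarith

open ENNReal in
lemma tsum_indicator_finset (J : Finset ℤ) :
    ∑' m : ℤ, (if m ∈ J then (1 : ℝ≥0∞) else 0) = J.card := by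
  rw [tsum_eq_sum (s := J) (fun m hm => if_neg hm), Finset.sum_ite_mem]
  simp

lemma card_le_tsum_tent_sq {δ : ℝ} (hδ : 0 < δ) :
    ENNReal.ofReal ((2 * tentRadius δ + 1) / 4) ≤ ∑' m, ENNReal.ofReal (tent δ m ^ 2) := by
  refine le_trans ?_ (ENNReal.sum_le_tsum (Finset.Icc (-(tentRadius δ : ℤ)) (tentRadius δ)))
  have h : ∀ m ∈ Finset.Icc (-(tentRadius δ : ℤ)) (tentRadius δ),
      ENNReal.ofReal (1 / 4) ≤ ENNReal.ofReal (tent δ m ^ 2) := fun m hm => by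
    refine ENNReal.ofReal_le_ofReal ?_
    nlinarith [half_le_tent hδ hm]
  refine le_trans ?_ (Finset.card_nsmul_le_sum _ _ _ h)
  rw [nsmul_eq_mul, Int.card_Icc, ← ENNReal.ofReal_natCast, ← ENNReal.ofReal_mul (by positivity)]
  refine ENNReal.ofReal_le_ofReal (le_of_eq ?_)
  have : ((tentRadius δ : ℤ) + 1 - -(tentRadius δ : ℤ)).toNat = 2 * tentRadius δ + 1 := by omega
  rw [this]
  push_cast
  ring

lemma tsum_tent_sq_ne_zero {δ : ℝ} (hδ : 0 < δ) : ∑' m, ENNReal.ofReal (tent δ m ^ 2) ≠ 0 := by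
  refine ne_of_gt (lt_of_lt_of_le ?_ (card_le_tsum_tent_sq hδ))
  rw [ENNReal.ofReal_pos]
  positivity

lemma tsum_tent_sq_ne_top {δ : ℝ} (hδ : 0 < δ) : ∑' m, ENNReal.ofReal (tent δ m ^ 2) ≠ ⊤ := by
  rw [tsum_eq_sum (s := Finset.Icc (-(2 * tentRadius δ + 1 : ℤ)) (2 * tentRadius δ + 1))
    (fun m hm => by simp [tent_eq_zero_of_notMem hδ hm])]
  exact ENNReal.sum_ne_top.mpr fun _ _ => ENNReal.ofReal_ne_top

lemma tsum_tent_sub_sq_le {δ : ℝ} (hδ : 0 < δ) (k : ℤ) :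
    ∑' m, ENNReal.ofReal ((tent δ (m - k) - tent δ m) ^ 2) ≤
      ENNReal.ofReal (24 * (k : ℝ) ^ 2 * δ ^ 2) * ∑' m, ENNReal.ofReal (tent δ m ^ 2) := by
  set J := Finset.Icc (-(2 * tentRadius δ + 1 : ℤ)) (2 * tentRadius δ + 1) with hJ
  set c : ℤ → ENNReal := fun m => if m ∈ J then 1 else 0 with hc
  have hpt : ∀ m, ENNReal.ofReal ((tent δ (m - k) - tent δ m) ^ 2) ≤
      ENNReal.ofReal ((δ * |(k : ℝ)|) ^ 2) * (c (m - k) + c m) := by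
    intro m
    have hle : ENNReal.ofReal ((tent δ (m - k) - tent δ m) ^ 2) ≤
        ENNReal.ofReal ((δ * |(k : ℝ)|) ^ 2) := by
      refine ENNReal.ofReal_le_ofReal ?_
      rw [← sq_abs (tent δ (m - k) - tent δ m)]
      gcongr
      exact abs_tent_sub_le hδ.le m k
    by_cases h1 : m - k ∈ J
    · refine hle.trans (le_mul_of_one_le_right' ?_)
      simp [hc, h1]
    · by_cases h2 : m ∈ J
      · refine hle.trans (le_mul_of_one_le_right' ?_)
        simp [hc, h2]
      · simp [tent_eq_zero_of_notMem hδ h1, tent_eq_zero_of_notMem hδ h2]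
  have hsum : ∑' m, c m = ENNReal.ofReal (4 * tentRadius δ + 3) := by
    rw [hc, tsum_indicator_finset, hJ, Int.card_Icc, ← ENNReal.ofReal_natCast]
    congr 1
    have : ((2 * tentRadius δ + 1 : ℤ) + 1 - -(2 * tentRadius δ + 1 : ℤ)).toNat
        = 4 * tentRadius δ + 3 := by omega
    rw [this]
    push_cast
    ring
  have hshift : ∑' m, c (m - k) = ∑' m, c m := (Equiv.subRight k).tsum_eq c
  calc ∑' m, ENNReal.ofReal ((tent δ (m - k) - tent δ m) ^ 2)
      ≤ ∑' m, ENNReal.ofReal ((δ * |(k : ℝ)|) ^ 2) * (c (m - k) + c m) := ENNReal.tsum_le_tsum hpt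
    _ = ENNReal.ofReal ((δ * |(k : ℝ)|) ^ 2 * (2 * (4 * tentRadius δ + 3))) := by
        rw [ENNReal.tsum_mul_left, ENNReal.tsum_add, hshift, hsum,
          ← ENNReal.ofReal_add (by positivity) (by positivity),
          ← ENNReal.ofReal_mul (by positivity)]
        ring_nf
    _ ≤ ENNReal.ofReal (24 * (k : ℝ) ^ 2 * δ ^ 2 * ((2 * tentRadius δ + 1) / 4)) := by
        refine ENNReal.ofReal_le_ofReal ?_
        rw [mul_pow, sq_abs]
        have : (0 : ℝ) ≤ tentRadius δ := by positivity
        have h2 : 0 ≤ δ ^ 2 * (k : ℝ) ^ 2 := by positivity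
        nlinarith [mul_nonneg h2 this]
    _ ≤ _ := by
        rw [ENNReal.ofReal_mul (by positivity)]
        gcongr
        exact card_le_tsum_tent_sq hδ

lemma ENNReal.tsum_tsum_sub_mul (a f : ℤ → ENNReal) :
    ∑' j, ∑' n, a (n - j) * f n = (∑' m, a m) * ∑' n, f n := by
  rw [ENNReal.tsum_comm, ← ENNReal.tsum_mul_left]
  refine tsum_congr fun n => ?_
  rw [ENNReal.tsum_mul_right, ← (Equiv.subLeft n).tsum_eq a]
  rfl

section SquareSummable

/-- The Hilbert space `ℓ²(ℤ, ℂ)`. -/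
abbrev EllTwo : Type := lp (fun _ : ℤ => ℂ) 2

lemma EllTwo.summable_norm_sq (u : EllTwo) : Summable fun n => ‖u n‖ ^ 2 := by
  simpa using (lp.memℓp u).summable (by simp)

lemma EllTwo.ofReal_norm_sq (u : EllTwo) :
    ENNReal.ofReal (‖u‖ ^ 2) = ∑' n, ENNReal.ofReal (‖u n‖ ^ 2) := by
  have h := lp.norm_rpow_eq_tsum (p := 2) (by simp) u
  simp only [ENNReal.toReal_ofNat, Real.rpow_ofNat] at h
  rw [h, ENNReal.ofReal_tsum_of_nonneg (fun _ => sq_nonneg _) u.summable_norm_sq]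

/-- Multiplication of `u` by the translate of `tent δ` centred at `j`. -/
noncomputable def tentMul {δ : ℝ} (hδ : 0 ≤ δ) (j : ℤ) (u : EllTwo) : EllTwo :=
  ⟨fun n => (tent δ (n - j) : ℂ) * u n, by
    refine memℓp_gen (Summable.of_nonneg_of_le (fun n => by positivity) (fun n => ?_)
      ((lp.memℓp u).summable (by simp)))
    refine Real.rpow_le_rpow (norm_nonneg _) ?_ (by simp)
    rw [norm_mul, Complex.norm_real, Real.norm_of_nonneg (tent_nonneg _ _)]
    exact mul_le_of_le_one_left (norm_nonneg _) (tent_le_one hδ _)⟩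

lemma tentMul_apply {δ : ℝ} (hδ : 0 ≤ δ) (j : ℤ) (u : EllTwo) (n : ℤ) :
    tentMul hδ j u n = (tent δ (n - j) : ℂ) * u n := rfl

lemma ofReal_norm_sq_tentMul {δ : ℝ} (hδ : 0 ≤ δ) (j : ℤ) (u : EllTwo) :
    ENNReal.ofReal (‖tentMul hδ j u‖ ^ 2) =
      ∑' n, ENNReal.ofReal (tent δ (n - j) ^ 2) * ENNReal.ofReal (‖u n‖ ^ 2) := by
  rw [EllTwo.ofReal_norm_sq]
  refine tsum_congr fun n => ?_
  rw [← ENNReal.ofReal_mul (sq_nonneg _), tentMul_apply, norm_mul, Complex.norm_real,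
    Real.norm_of_nonneg (tent_nonneg _ _), mul_pow]

lemma EllTwo.summable_conj_mul (u v : EllTwo) (k : ℤ) :
    Summable fun n => starRingEnd ℂ (u (n - k)) * v n := by
  have h1 : Summable fun n => ‖u (n - k)‖ ^ 2 :=
    (Equiv.subRight k).summable_iff.mpr u.summable_norm_sq
  refine Summable.of_norm_bounded (h1.add v.summable_norm_sq) fun n => ?_
  rw [norm_mul, RCLike.norm_conj]
  nlinarith [sq_nonneg (‖u (n - k)‖ - ‖v n‖), sq_nonneg ‖u (n - k)‖, sq_nonneg ‖v n‖]

end SquareSummable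

section FiniteRange

variable {d : ℕ} {vhat : ℤ → ℂ}

lemma isSelfAdjoint_of_apply_eq (hv : ∀ k : ℤ, vhat (-k) = starRingEnd ℂ (vhat k))
    {q : ℤ → ℝ} {L : EllTwo →L[ℂ] EllTwo}
    (hL : ∀ (u : EllTwo) (n : ℤ), L u n =
      (∑ k ∈ Finset.Icc (-(d : ℤ)) (d : ℤ), vhat k * u (n - k)) + (q n : ℂ) * u n) :
    IsSelfAdjoint L := by
  rw [ContinuousLinearMap.isSelfAdjoint_iff_isSymmetric]
  intro u v
  change inner ℂ (L u) v = inner ℂ u (L v)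
  have hconv : ∀ u v : EllTwo, ∀ k, Summable fun n =>
      starRingEnd ℂ (vhat k) * (starRingEnd ℂ (u (n - k)) * v n) :=
    fun u v k => (u.summable_conj_mul v k).mul_left _
  have hleft : ∀ n, inner ℂ (L u n) (v n) =
      (∑ k ∈ Finset.Icc (-(d : ℤ)) (d : ℤ),
        starRingEnd ℂ (vhat k) * (starRingEnd ℂ (u (n - k)) * v n))
      + (q n : ℂ) * (starRingEnd ℂ (u n) * v n) := fun n => by
    rw [hL, RCLike.inner_apply, map_add, map_sum, mul_add, Finset.mul_sum]
    simp only [map_mul, Complex.conj_ofReal]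
    congr 1
    · exact Finset.sum_congr rfl fun k _ => by ring
    · ring
  have hright : ∀ n, inner ℂ (u n) (L v n) =
      (∑ k ∈ Finset.Icc (-(d : ℤ)) (d : ℤ),
        vhat k * (starRingEnd ℂ (u n) * v (n - k)))
      + (q n : ℂ) * (starRingEnd ℂ (u n) * v n) := fun n => by
    rw [hL, RCLike.inner_apply, add_mul, Finset.sum_mul]
    congr 1
    · exact Finset.sum_congr rfl fun k _ => by ring
    · ring
  have hr : ∀ k, Summable fun n => vhat k * (starRingEnd ℂ (u n) * v (n - k)) := fun k => by
    refine Summable.mul_left _ ?_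
    refine (Equiv.addRight k).summable_iff.mp ?_
    refine (u.summable_conj_mul v (-k)).congr fun n => ?_
    simp
  have hsl := summable_sum fun k (_ : k ∈ Finset.Icc (-(d : ℤ)) (d : ℤ)) => hconv u v k
  have hsr := summable_sum fun k (_ : k ∈ Finset.Icc (-(d : ℤ)) (d : ℤ)) => hr k
  have hinl := lp.summable_inner (𝕜 := ℂ) (L u) v
  have hq : Summable fun n => (q n : ℂ) * (starRingEnd ℂ (u n) * v n) := by
    refine (hinl.sub hsl).congr fun n => ?_
    rw [hleft]
    ring
  rw [lp.inner_eq_tsum, lp.inner_eq_tsum, tsum_congr hleft, tsum_congr hright,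
    hsl.tsum_add hq, hsr.tsum_add hq, Summable.tsum_finsetSum fun k _ => hconv u v k,
    Summable.tsum_finsetSum fun k _ => hr k]
  congr 1
  refine Finset.sum_bij' (fun k _ => -k) (fun k _ => -k) ?_ ?_ ?_ ?_ ?_
  · intro k hk
    rw [Finset.mem_Icc] at hk ⊢
    omega
  · intro k hk
    rw [Finset.mem_Icc] at hk ⊢
    omega
  · simp
  · simp
  · intro k _
    rw [hv, tsum_mul_left, tsum_mul_left, ← (Equiv.addRight k).tsum_eq]
    simp

/-- Localizing by a tent function commutes with a finite-range operator up to a commutator, and a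
perturbation of the diagonal that vanishes at the centre is small on the support of the tent. -/
lemma norm_sq_localized_apply_le {q q' : ℤ → ℝ} {L L' : EllTwo →L[ℂ] EllTwo}
    (hL : ∀ (u : EllTwo) (n : ℤ), L u n =
      (∑ k ∈ Finset.Icc (-(d : ℤ)) (d : ℤ), vhat k * u (n - k)) + (q n : ℂ) * u n)
    (hL' : ∀ (u : EllTwo) (n : ℤ), L' u n =
      (∑ k ∈ Finset.Icc (-(d : ℤ)) (d : ℤ), vhat k * u (n - k)) + (q' n : ℂ) * u n)
    {δ l : ℝ} (hδ : 0 ≤ δ) (hl : 0 ≤ l) (x : ℂ) (j : ℤ)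
    (hq : ∀ n, |q n - q' n| ≤ l * δ ^ 2 * |((n - j : ℤ) : ℝ)|) (u : EllTwo) (n : ℤ) :
    ‖(L (tentMul hδ j u) - x • tentMul hδ j u) n‖ ^ 2 ≤
      3 * (tent δ (n - j) ^ 2 * ‖(L' u - x • u) n‖ ^ 2
        + (∑ k ∈ Finset.Icc (-(d : ℤ)) (d : ℤ), ‖vhat k‖ ^ 2) *
          ∑ k ∈ Finset.Icc (-(d : ℤ)) (d : ℤ),
            (tent δ (n - j - k) - tent δ (n - j)) ^ 2 * ‖u (n - k)‖ ^ 2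
        + l ^ 2 * δ ^ 2 * (tent δ (n - j) ^ 2 * ‖u n‖ ^ 2)) := by
  set I := Finset.Icc (-(d : ℤ)) (d : ℤ)
  set η := tent δ (n - j) with hη
  have hη0 : 0 ≤ η := tent_nonneg _ _
  set g := (L' u - x • u) n with hg
  set c := ∑ k ∈ I, vhat k * (((tent δ (n - j - k) - η : ℝ) : ℂ) * u (n - k)) with hc
  set e := ((q n - q' n : ℝ) : ℂ) * ((η : ℂ) * u n) with he
  have hsplit : (L (tentMul hδ j u) - x • tentMul hδ j u) n = (η : ℂ) * g + c + e := by
    have h1 : ∀ k, tentMul hδ j u (n - k) = (tent δ (n - j - k) : ℂ) * u (n - k) := fun k => by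
      rw [tentMul_apply, sub_right_comm]
    have h2 : (∑ k ∈ I, vhat k * ((tent δ (n - j - k) : ℂ) * u (n - k))) =
        c + η * ∑ k ∈ I, vhat k * u (n - k) := by
      rw [hc, Finset.mul_sum, ← Finset.sum_add_distrib]
      refine Finset.sum_congr rfl fun k _ => ?_
      push_cast
      ring
    rw [hg, he, lp.coeFn_sub, lp.coeFn_sub, lp.coeFn_smul, lp.coeFn_smul, Pi.sub_apply,
      Pi.sub_apply, Pi.smul_apply, Pi.smul_apply, hL, hL', smul_eq_mul, smul_eq_mul]
    simp only [h1]
    rw [h2, tentMul_apply]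
    push_cast
    ring
  have hcn : ‖c‖ ^ 2 ≤ (∑ k ∈ I, ‖vhat k‖ ^ 2) *
      ∑ k ∈ I, (tent δ (n - j - k) - η) ^ 2 * ‖u (n - k)‖ ^ 2 := by
    have h1 : ‖c‖ ≤ ∑ k ∈ I, ‖vhat k‖ * (|tent δ (n - j - k) - η| * ‖u (n - k)‖) := by
      refine norm_sum_le_of_le _ fun k _ => ?_
      rw [norm_mul, norm_mul, Complex.norm_real, Real.norm_eq_abs]
    calc ‖c‖ ^ 2 ≤ (∑ k ∈ I, ‖vhat k‖ * (|tent δ (n - j - k) - η| * ‖u (n - k)‖)) ^ 2 := by gcongr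
      _ ≤ _ := Finset.sum_mul_sq_le_sq_mul_sq _ _ _
      _ = _ := by simp only [mul_pow, sq_abs]
  have hen : ‖e‖ ^ 2 ≤ l ^ 2 * δ ^ 2 * (η ^ 2 * ‖u n‖ ^ 2) := by
    have h1 : |q n - q' n| * η ≤ l * δ * η := by
      calc |q n - q' n| * η ≤ l * δ ^ 2 * |((n - j : ℤ) : ℝ)| * η := by gcongr; exact hq n
        _ = l * δ * (δ * |((n - j : ℤ) : ℝ)| * η) := by ring
        _ ≤ l * δ * η := by gcongr; exact mul_abs_mul_tent_le δ (n - j)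
    have h2 : ‖e‖ ≤ l * δ * η * ‖u n‖ := by
      rw [he, norm_mul, norm_mul, Complex.norm_real, Complex.norm_real, Real.norm_eq_abs,
        Real.norm_of_nonneg hη0, ← mul_assoc]
      gcongr
    calc ‖e‖ ^ 2 ≤ (l * δ * η * ‖u n‖) ^ 2 := by gcongr
      _ = _ := by ring
  have hgn : ‖(η : ℂ) * g‖ ^ 2 = η ^ 2 * ‖g‖ ^ 2 := by
    rw [norm_mul, Complex.norm_real, Real.norm_of_nonneg hη0, mul_pow]
  rw [hsplit]
  have htri : ‖(η : ℂ) * g + c + e‖ ^ 2 ≤ (‖(η : ℂ) * g‖ + ‖c‖ + ‖e‖) ^ 2 := by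
    gcongr
    exact norm_add₃_le
  nlinarith [sq_nonneg (‖(η : ℂ) * g‖ - ‖c‖), sq_nonneg (‖(η : ℂ) * g‖ - ‖e‖),
    sq_nonneg (‖c‖ - ‖e‖)]

lemma lower_bound_of_localized {L : ℤ → EllTwo →L[ℂ] EllTwo} {L' : EllTwo →L[ℂ] EllTwo}
    {q : ℤ → ℤ → ℝ} {q' : ℤ → ℝ}
    (hL : ∀ (j : ℤ) (u : EllTwo) (n : ℤ), L j u n =
      (∑ k ∈ Finset.Icc (-(d : ℤ)) (d : ℤ), vhat k * u (n - k)) + (q j n : ℂ) * u n)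
    (hL' : ∀ (u : EllTwo) (n : ℤ), L' u n =
      (∑ k ∈ Finset.Icc (-(d : ℤ)) (d : ℤ), vhat k * u (n - k)) + (q' n : ℂ) * u n)
    {δ l r : ℝ} (hδ : 0 < δ) (hl : 0 ≤ l) (hr : 0 ≤ r) (x : ℂ)
    (hq : ∀ j n, |q j n - q' n| ≤ l * δ ^ 2 * |((n - j : ℤ) : ℝ)|)
    (hlow : ∀ j u, r * ‖u‖ ≤ ‖L j u - x • u‖) (u : EllTwo) :
    r ^ 2 * ‖u‖ ^ 2 ≤ 3 * (‖L' u - x • u‖ ^ 2 +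
      ((∑ k ∈ Finset.Icc (-(d : ℤ)) (d : ℤ), ‖vhat k‖ ^ 2) *
        (∑ k ∈ Finset.Icc (-(d : ℤ)) (d : ℤ), 24 * (k : ℝ) ^ 2) + l ^ 2) * δ ^ 2 * ‖u‖ ^ 2) := by
  set I := Finset.Icc (-(d : ℤ)) (d : ℤ)
  set A := ∑ k ∈ I, ‖vhat k‖ ^ 2
  have hA : 0 ≤ A := Finset.sum_nonneg fun _ _ => sq_nonneg _
  set S := ∑' m, ENNReal.ofReal (tent δ m ^ 2) with hS
  set G := L' u - x • u
  set Q := ENNReal.ofReal (‖u‖ ^ 2)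
  have hpt : ∀ j, ENNReal.ofReal (r ^ 2) *
        ∑' n, ENNReal.ofReal (tent δ (n - j) ^ 2) * ENNReal.ofReal (‖u n‖ ^ 2) ≤
      ∑' n, 3 * (ENNReal.ofReal (tent δ (n - j) ^ 2) * ENNReal.ofReal (‖G n‖ ^ 2)
        + ENNReal.ofReal A * ∑ k ∈ I,
            ENNReal.ofReal ((tent δ (n - j - k) - tent δ (n - j)) ^ 2) *
              ENNReal.ofReal (‖u (n - k)‖ ^ 2)
        + ENNReal.ofReal (l ^ 2 * δ ^ 2) *
          (ENNReal.ofReal (tent δ (n - j) ^ 2) * ENNReal.ofReal (‖u n‖ ^ 2))) := by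
    intro j
    rw [← ofReal_norm_sq_tentMul hδ.le, ← ENNReal.ofReal_mul (sq_nonneg r), ← mul_pow]
    have h1 : (r * ‖tentMul hδ.le j u‖) ^ 2 ≤
        ‖L j (tentMul hδ.le j u) - x • tentMul hδ.le j u‖ ^ 2 := by
      gcongr
      exact hlow j _
    refine (ENNReal.ofReal_le_ofReal h1).trans ?_
    rw [EllTwo.ofReal_norm_sq]
    refine ENNReal.tsum_le_tsum fun n => ?_
    refine (ENNReal.ofReal_le_ofReal
      (norm_sq_localized_apply_le (hL j) hL' hδ.le hl x j (hq j) u n)).trans (le_of_eq ?_)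
    have h2 : ∀ k ∈ I, 0 ≤ (tent δ (n - j - k) - tent δ (n - j)) ^ 2 * ‖u (n - k)‖ ^ 2 :=
      fun k _ => by positivity
    have h3 := Finset.sum_nonneg h2
    rw [ENNReal.ofReal_mul (by norm_num), ENNReal.ofReal_add (by positivity) (by positivity),
      ENNReal.ofReal_add (by positivity) (by positivity), ENNReal.ofReal_mul (by positivity),
      ENNReal.ofReal_mul hA, ENNReal.ofReal_mul (by positivity),
      ENNReal.ofReal_mul (by positivity), ENNReal.ofReal_sum_of_nonneg h2, ENNReal.ofReal_ofNat]
    simp only [ENNReal.ofReal_mul (sq_nonneg _)]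
    rfl
  have hcomm : ∀ k, ∑' j, ∑' n,
      ENNReal.ofReal ((tent δ (n - j - k) - tent δ (n - j)) ^ 2) *
        ENNReal.ofReal (‖u (n - k)‖ ^ 2) ≤
      ENNReal.ofReal (24 * (k : ℝ) ^ 2 * δ ^ 2) * S * Q := fun k => by
    rw [ENNReal.tsum_tsum_sub_mul
      (fun m => ENNReal.ofReal ((tent δ (m - k) - tent δ m) ^ 2))
      (fun n => ENNReal.ofReal (‖u (n - k)‖ ^ 2))]
    have h1 : ∑' n, ENNReal.ofReal (‖u (n - k)‖ ^ 2) = Q :=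
      ((Equiv.subRight k).tsum_eq fun n => ENNReal.ofReal (‖u n‖ ^ 2)).trans u.ofReal_norm_sq.symm
    rw [h1]
    gcongr
    exact tsum_tent_sub_sq_le hδ k
  have hsum := ENNReal.tsum_le_tsum hpt
  rw [ENNReal.tsum_mul_left] at hsum
  simp only [ENNReal.tsum_mul_left, ENNReal.tsum_add,
    Summable.tsum_finsetSum fun _ _ => ENNReal.summable] at hsum
  rw [ENNReal.tsum_tsum_sub_mul (fun m => ENNReal.ofReal (tent δ m ^ 2)),
    ENNReal.tsum_tsum_sub_mul (fun m => ENNReal.ofReal (tent δ m ^ 2)), ← hS,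
    ← EllTwo.ofReal_norm_sq, ← EllTwo.ofReal_norm_sq] at hsum
  have hfin : S * ENNReal.ofReal (r ^ 2 * ‖u‖ ^ 2) ≤
      S * ENNReal.ofReal (3 * (‖G‖ ^ 2 + (A * (∑ k ∈ I, 24 * (k : ℝ) ^ 2) + l ^ 2) * δ ^ 2
        * ‖u‖ ^ 2)) := by
    calc S * ENNReal.ofReal (r ^ 2 * ‖u‖ ^ 2) = ENNReal.ofReal (r ^ 2) * (S * Q) := by
          rw [ENNReal.ofReal_mul (sq_nonneg r)]
          ring
      _ ≤ _ := hsum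
      _ ≤ 3 * (S * ENNReal.ofReal (‖G‖ ^ 2) + ENNReal.ofReal A *
            ∑ k ∈ I, ENNReal.ofReal (24 * (k : ℝ) ^ 2 * δ ^ 2) * S * Q
          + ENNReal.ofReal (l ^ 2 * δ ^ 2) * (S * Q)) := by
          gcongr with k _
          exact hcomm k
      _ = _ := by
          have hK : 0 ≤ ∑ k ∈ I, 24 * (k : ℝ) ^ 2 * δ ^ 2 :=
            Finset.sum_nonneg fun _ _ => by positivity
          have h1 : 3 * (‖G‖ ^ 2 + (A * (∑ k ∈ I, 24 * (k : ℝ) ^ 2) + l ^ 2) * δ ^ 2 * ‖u‖ ^ 2)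
              = 3 * (‖G‖ ^ 2 + A * (∑ k ∈ I, 24 * (k : ℝ) ^ 2 * δ ^ 2) * ‖u‖ ^ 2
                + l ^ 2 * δ ^ 2 * ‖u‖ ^ 2) := by
            rw [← Finset.sum_mul]
            ring
          rw [h1, ENNReal.ofReal_mul (p := 3) (by norm_num),
            ENNReal.ofReal_add (by positivity) (by positivity),
            ENNReal.ofReal_add (by positivity) (by positivity),
            ENNReal.ofReal_mul (p := A * _) (by positivity), ENNReal.ofReal_mul hA,
            ENNReal.ofReal_mul (p := l ^ 2 * δ ^ 2) (by positivity),
            ENNReal.ofReal_sum_of_nonneg (f := fun k : ℤ => 24 * (k : ℝ) ^ 2 * δ ^ 2)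
              (fun _ _ => by positivity), ENNReal.ofReal_ofNat,
            ← Finset.sum_mul, ← Finset.sum_mul]
          change _ = S * (3 * (_ + _ * _ * Q + _ * Q))
          ring
  rw [ENNReal.mul_le_mul_iff_right (tsum_tent_sq_ne_zero hδ) (tsum_tent_sq_ne_top hδ)] at hfin
  refine (ENNReal.ofReal_le_ofReal_iff ?_).mp hfin
  have hK : 0 ≤ ∑ k ∈ I, 24 * (k : ℝ) ^ 2 := Finset.sum_nonneg fun _ _ => by positivity
  positivity

end FiniteRange

/-- Stability of spectral gaps under `1/2`-Hölder continuity of the spectra `σ_α`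
of the finite-range operators `L_{α,θ}` on `ℓ²(ℤ,ℂ)`:  there exist constants
`C̃, C > 0` depending only on `d`, the coefficients `v̂` and `w` such that if the
open interval `(a,b)` is disjoint from `σ_α`, `|α - α'| < C̃`, and
`a + C|α-α'|^{1/2} < b - C|α-α'|^{1/2}`, then the open interval
`(a + C|α-α'|^{1/2}, b - C|α-α'|^{1/2})` is disjoint from `σ_{α'}`. -/
theorem gap_half_holder_continuity
    (d : ℕ) (hd : 1 ≤ d)
    (vhat : ℤ → ℂ) (hv : ∀ k : ℤ, vhat (-k) = starRingEnd ℂ (vhat k))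
    (w : ℝ → ℝ) (hw : ContDiff ℝ 1 w) (hwper : Function.Periodic w 1)
    (Lop : ℝ → ℝ → (lp (fun _ : ℤ => ℂ) 2 →L[ℂ] lp (fun _ : ℤ => ℂ) 2))
    (hLop : ∀ (α θ : ℝ) (u : lp (fun _ : ℤ => ℂ) 2) (n : ℤ),
      (Lop α θ u : ∀ _ : ℤ, ℂ) n
        = (∑ k ∈ Finset.Icc (-(d : ℤ)) (d : ℤ), vhat k * (u : ∀ _ : ℤ, ℂ) (n - k))
          + (w (θ + (n : ℝ) * α) : ℂ) * (u : ∀ _ : ℤ, ℂ) n) :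
    ∃ Ctil > (0 : ℝ), ∃ C > (0 : ℝ), ∀ α α' a b : ℝ, a < b →
      (∀ lam : ℂ, (∃ θ : ℝ, lam ∈ spectrum ℂ (Lop α θ)) →
          lam ∉ (Complex.ofReal '' Set.Ioo a b)) →
      |α - α'| < Ctil →
      a + C * Real.sqrt |α - α'| < b - C * Real.sqrt |α - α'| →
      ∀ lam : ℂ, (∃ θ' : ℝ, lam ∈ spectrum ℂ (Lop α' θ')) →
        lam ∉ (Complex.ofReal ''
          Set.Ioo (a + C * Real.sqrt |α - α'|) (b - C * Real.sqrt |α - α'|)) := by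
  obtain ⟨l, hl, hlip⟩ := hwper.exists_lipschitz hw one_ne_zero
  set B := (∑ k ∈ Finset.Icc (-(d : ℤ)) (d : ℤ), ‖vhat k‖ ^ 2) *
    (∑ k ∈ Finset.Icc (-(d : ℤ)) (d : ℤ), 24 * (k : ℝ) ^ 2) + l ^ 2 with hB
  have hB0 : 0 ≤ B := add_nonneg (mul_nonneg (Finset.sum_nonneg fun _ _ => sq_nonneg _)
    (Finset.sum_nonneg fun _ _ => by positivity)) (sq_nonneg l)
  have hCpos : 0 < Real.sqrt (3 * B + 3) := Real.sqrt_pos.mpr (by positivity)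
  refine ⟨1, one_pos, Real.sqrt (3 * B + 3), hCpos, ?_⟩
  set C := Real.sqrt (3 * B + 3) with hC
  have hCsq : C ^ 2 = 3 * B + 3 := Real.sq_sqrt (by positivity)
  rintro α α' a b - hgap - - lam ⟨θ', hlam⟩ ⟨x, ⟨hxa, hxb⟩, rfl⟩
  have hsa : ∀ α θ, IsSelfAdjoint (Lop α θ) := fun α θ =>
    isSelfAdjoint_of_apply_eq hv (hLop α θ)
  set δ := Real.sqrt |α - α'| with hδdef
  have hδ0 : 0 ≤ δ := Real.sqrt_nonneg _
  have hδsq : δ ^ 2 = |α - α'| := Real.sq_sqrt (abs_nonneg _)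
  rcases hδ0.eq_or_lt with h0 | hδ
  · have hαα' : α = α' := by
      rw [← h0] at hδsq
      exact sub_eq_zero.mp (abs_eq_zero.mp (by simpa using hδsq.symm))
    subst hαα'
    rw [← h0] at hxa hxb
    exact hgap x ⟨θ', hlam⟩ ⟨x, ⟨by linarith, by linarith⟩, rfl⟩
  have hCδ : 0 < C * δ := mul_pos hCpos hδ
  have hlow : ∀ θ u, C * δ * ‖u‖ ≤ ‖Lop α θ u - (x : ℂ) • u‖ := by
    intro θ u
    refine (hsa α θ).mul_norm_le_norm_sub_of_spectrum hCδ (fun y hy hmem => ?_) u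
    rw [abs_lt] at hy
    exact hgap _ ⟨θ, hmem⟩ ⟨x + y, ⟨by linarith, by linarith⟩, rfl⟩
  have hbelow : ∀ u, δ * ‖u‖ ≤ ‖Lop α' θ' u - (x : ℂ) • u‖ := by
    intro u
    have h := lower_bound_of_localized
      (L := fun j : ℤ => Lop α (θ' + j * α' - j * α))
      (fun j => hLop α (θ' + j * α' - j * α)) (hLop α' θ') hδ hl hCδ.le x (fun j n => by
        refine (hlip _ _).trans (le_of_eq ?_)
        rw [hδsq, mul_assoc, ← abs_mul]
        congr 2
        push_cast
        ring) (fun j => hlow _) u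
    rw [← hB, mul_pow, hCsq] at h
    refine le_of_sq_le_sq ?_ (norm_nonneg _)
    nlinarith
  exact (hsa α' θ').notMem_spectrum_of_mul_norm_le hδ hbelow hlam
end

section
/- Let Ω ⊆ ℂⁿ be a nonempty open connected contractible set, closed under componentwise complex conjugation and with Ω ∩ ℝⁿ ≠ ∅, let δ > 0, and let 1 ≤ m < d. Let M : Ω × S_δ → ℂ^{2d×2m} and N : Ω × S_δ → ℂ^{2d×(2d−2m)} be holomorphic, 1-periodic in the second variable, of full column rank at every point, such that ℂ^{2d} = col M(x,z) ⊕ col N(x,z) for all (x,z) (where col denotes column span), and such that for every real point (x,z) ∈ (Ω∩ℝⁿ) × ℝ, col N(x,z) = (col M(x,z))^{⊥ω}. Then: (1) M(x̄,z̄)* 𝒥_{2d} N(x,z) = 0 for all (x,z) ∈ Ω × S_δ, i.e. col N(x,z) = (col M(x̄,z̄))^{⊥ω}; (2) the Krein matrix G(x,z) = (1/i)·M(x̄,z̄)* 𝒥_{2d} M(x,z) is invertible for every (x,z) ∈ Ω × S_δ. Here x̄, z̄ denote componentwise complex conjugates. -/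
open scoped BigOperators Matrix

/-- The horizontal strip `S_h = {z : |Im z| < h}`. -/
def strip (h : ℝ) : Set ℂ := {z : ℂ | |z.im| < h}

/-- Identification `Fin d ⊕ Fin d ≃ Fin (2d)`. -/
def sumEquiv (d : ℕ) : Fin d ⊕ Fin d ≃ Fin (2 * d) :=
  finSumFinEquiv.trans (finCongr (by omega))

/-- The standard symplectic matrix `𝒥_{2d} = (0, I_d; -I_d, 0)`. -/
noncomputable def Jmat (d : ℕ) : Matrix (Fin (2 * d)) (Fin (2 * d)) ℂ :=
  Matrix.reindex (sumEquiv d) (sumEquiv d) (Matrix.fromBlocks 0 1 (-1) 0)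

open Filter Topology in
/-- One-variable identity principle along a complex line in a convex open set. -/
lemma DifferentiableOn.eq_zero_of_frequently_eq_zero_on_line
    {E : Type*} [NormedAddCommGroup E] [NormedSpace ℂ E] {f : E → ℂ} {U : Set E}
    (hU : IsOpen U) (hconv : Convex ℝ U) (hf : DifferentiableOn ℂ f U) {q v : E} {c : ℂ}
    (hq : q ∈ U) (hc : q + c • v ∈ U) (h : ∃ᶠ ζ : ℂ in 𝓝[≠] 0, f (q + ζ • v) = 0) :
    f (q + c • v) = 0 := by
  have hline : Differentiable ℂ (fun ζ : ℂ => q + ζ • v) := by fun_prop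
  let D : Set ℂ := (fun ζ : ℂ => q + ζ • v) ⁻¹' U
  have hDo : IsOpen D := hU.preimage hline.continuous
  have hDc : Convex ℝ D := by
    intro a ha b hb s t hs ht hst
    have hmem := hconv ha hb hs ht hst
    have hcomb : s • (q + a • v) + t • (q + b • v) = q + (s • a + t • b) • v := by
      rw [smul_add, smul_add, add_smul, smul_assoc, smul_assoc, add_add_add_comm, ← add_smul,
        hst, one_smul]
    exact Set.mem_preimage.2 (hcomb ▸ hmem)
  have hfD : AnalyticOnNhd ℂ (fun ζ : ℂ => f (q + ζ • v)) D :=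
    (hf.comp hline.differentiableOn fun _ hζ => hζ).analyticOnNhd hDo
  have h0 : (0 : ℂ) ∈ D := by simpa [D] using hq
  exact hfD.eqOn_zero_of_preconnected_of_frequently_eq_zero hDc.isPreconnected h0 h hc

open Filter Topology in
/-- Identity principle for a complex differentiable function on a preconnected open subset of a
complex normed space. -/
lemma DifferentiableOn.eqOn_zero_of_eventuallyEq_zero
    {E : Type*} [NormedAddCommGroup E] [NormedSpace ℂ E] {f : E → ℂ} {U : Set E}
    (hU : IsOpen U) (hconn : IsPreconnected U) (hf : DifferentiableOn ℂ f U) {p₀ : E}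
    (hp₀ : p₀ ∈ U) (h : f =ᶠ[𝓝 p₀] 0) : Set.EqOn f 0 U := by
  have hsub : U ⊆ {p | f =ᶠ[𝓝 p] 0} := by
    refine hconn.subset_of_closure_inter_subset isOpen_setOfPred_eventually_nhds ⟨p₀, hp₀, h⟩ ?_
    rintro p ⟨hpc, hpU⟩
    obtain ⟨r, hr, hball⟩ := Metric.isOpen_iff.1 hU p hpU
    obtain ⟨q, hq0, hq⟩ := Metric.mem_closure_iff.1 hpc r hr
    filter_upwards [Metric.ball_mem_nhds p hr] with p' hp'
    have hzero : ∀ᶠ ζ : ℂ in 𝓝 0, f (q + ζ • (p' - q)) = 0 := by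
      have hcont : Continuous fun ζ : ℂ => q + ζ • (p' - q) := by fun_prop
      have ht := hcont.tendsto 0
      rw [zero_smul, add_zero] at ht
      exact ht.eventually hq0
    have := (hf.mono hball).eq_zero_of_frequently_eq_zero_on_line Metric.isOpen_ball
      (convex_ball p r) (q := q) (v := p' - q) (c := 1) (by simpa [dist_comm] using hq)
      (by simpa using hp') (hzero.filter_mono nhdsWithin_le_nhds).frequently
    simpa using this
  exact fun p hp => (hsub hp).self_of_nhds

open Filter Topology ComplexStarModule in
/-- A holomorphic function vanishing at the self-adjoint points of a preconnected open set that
contains such a point vanishes identically. -/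
lemma DifferentiableOn.eqOn_zero_of_isSelfAdjoint
    {E : Type*} [NormedAddCommGroup E] [NormedSpace ℂ E] [StarAddMonoid E] [StarModule ℂ E]
    [ContinuousStar E] {f : E → ℂ} {U : Set E}
    (hU : IsOpen U) (hconn : IsPreconnected U) (hf : DifferentiableOn ℂ f U) {p₀ : E}
    (hp₀ : p₀ ∈ U) (hsa : IsSelfAdjoint p₀) (h : ∀ p ∈ U, IsSelfAdjoint p → f p = 0) :
    Set.EqOn f 0 U := by
  refine hf.eqOn_zero_of_eventuallyEq_zero hU hconn hp₀ ?_
  obtain ⟨r, hr, hball⟩ := Metric.isOpen_iff.1 hU p₀ hp₀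
  have hre : Tendsto (fun p : E => ((ℜ p : selfAdjoint E) : E)) (𝓝 p₀) (𝓝 p₀) := by
    have hcont : Continuous fun p : E => ((ℜ p : selfAdjoint E) : E) := by
      simp only [realPart_apply_coe]
      fun_prop
    simpa [hsa.coe_realPart] using hcont.tendsto p₀
  filter_upwards [Metric.ball_mem_nhds p₀ hr, hre (Metric.ball_mem_nhds p₀ hr)] with p hp hrep
  have hcont : Continuous fun t : ℝ => ((ℜ p : selfAdjoint E) : E) + (t : ℂ) • (ℑ p : E) := by
    fun_prop
  have hzero : ∀ᶠ t : ℝ in 𝓝 0, f ((ℜ p : E) + (t : ℂ) • (ℑ p : E)) = 0 := by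
    have ht := hcont.tendsto 0
    rw [Complex.ofReal_zero, zero_smul, add_zero] at ht
    filter_upwards [ht (Metric.isOpen_ball.mem_nhds hrep)] with t ht
    refine h _ (hball ht) ((ℜ p).2.add ?_)
    exact IsSelfAdjoint.smul (Complex.conj_ofReal t) (ℑ p).2
  have hofReal : Tendsto (fun t : ℝ => (t : ℂ)) (𝓝[≠] 0) (𝓝[≠] 0) :=
    Complex.continuous_ofReal.continuousWithinAt.tendsto_nhdsWithin
      fun t ht => by simpa using ht
  have := (hf.mono hball).eq_zero_of_frequently_eq_zero_on_line Metric.isOpen_ball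
    (convex_ball p₀ r) (q := (ℜ p : E)) (v := (ℑ p : E)) (c := Complex.I) hrep
    (by rwa [realPart_add_I_smul_imaginaryPart])
    (hofReal.frequently (hzero.filter_mono nhdsWithin_le_nhds).frequently)
  rwa [realPart_add_I_smul_imaginaryPart] at this

lemma isUnit_Jmat (d : ℕ) : IsUnit (Jmat d) := by
  have hJ : Matrix.fromBlocks 0 1 (-1) 0 = -Matrix.J (Fin d) ℂ := by
    simp [Matrix.J, Matrix.fromBlocks_neg]
  rw [Matrix.isUnit_iff_isUnit_det, Jmat, Matrix.det_reindex_self, hJ,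
    ← Matrix.isUnit_iff_isUnit_det, IsUnit.neg_iff, Matrix.isUnit_iff_isUnit_det]
  exact Matrix.isUnit_det_J _ _

lemma isOpen_strip (h : ℝ) : IsOpen (strip h) :=
  isOpen_lt (by fun_prop) continuous_const

lemma convex_strip (h : ℝ) : Convex ℝ (strip h) := by
  have : strip h = Complex.imLm ⁻¹' Set.Ioo (-h) h := by
    ext z
    simp [strip, abs_lt]
  rw [this]
  exact (convex_Ioo _ _).linear_preimage _

lemma star_mem_strip {h : ℝ} {z : ℂ} (hz : z ∈ strip h) : star z ∈ strip h := by
  simpa [strip] using hz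

lemma Matrix.range_mulVecLin_eq_ker_of_rank_add_rank {K k l m : Type*} [Field K]
    [Fintype k] [Fintype l] [Fintype m] {A : Matrix k l K} {B : Matrix l m K}
    (hAB : A * B = 0) (hrank : A.rank + B.rank = Fintype.card l) :
    LinearMap.range B.mulVecLin = LinearMap.ker A.mulVecLin := by
  refine Submodule.eq_of_le_of_finrank_eq ?_ ?_
  · rintro _ ⟨c, rfl⟩
    simp [Matrix.mulVec_mulVec, hAB]
  · have := A.mulVecLin.finrank_range_add_finrank_ker
    rw [Module.finrank_fintype_fun_eq_card] at this
    simp only [Matrix.rank] at hrank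
    omega

lemma Matrix.isUnit_mul_of_disjoint_range_ker {K l m : Type*} [Field K]
    [Fintype l] [Fintype m] [DecidableEq m] {A : Matrix m l K} {B : Matrix l m K}
    (hB : B.rank = Fintype.card m)
    (hdisj : Disjoint (LinearMap.range B.mulVecLin) (LinearMap.ker A.mulVecLin)) :
    IsUnit (A * B) := by
  have hker : LinearMap.ker B.mulVecLin = ⊥ := by
    have := B.mulVecLin.finrank_range_add_finrank_ker
    rw [Module.finrank_fintype_fun_eq_card] at this
    rw [Matrix.rank] at hB
    exact Submodule.finrank_eq_zero.1 (by omega)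
  rw [← Matrix.mulVec_injective_iff_isUnit]
  change Function.Injective (A * B).mulVecLin
  rw [← LinearMap.ker_eq_bot, LinearMap.ker_eq_bot']
  intro c hc
  have hBc : B.mulVecLin c = 0 :=
    Submodule.disjoint_def.1 hdisj _ ⟨c, rfl⟩ (by simpa [Matrix.mulVec_mulVec] using hc)
  exact LinearMap.ker_eq_bot'.1 hker c hBc

open scoped ComplexOrder in
lemma Matrix.rank_conjTranspose_eq {l m : Type*} [Fintype l] [Fintype m]
    (A : Matrix l m ℂ) : Aᴴ.rank = A.rank :=
  A.rank_conjTranspose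

lemma Matrix.star_mulVec_dotProduct_mulVec {l m k : Type*} [Fintype l] [Fintype m] [Fintype k]
    (A : Matrix l m ℂ) (J : Matrix l k ℂ) (c : m → ℂ) (w : k → ℂ) :
    star (A.mulVec c) ⬝ᵥ J.mulVec w = star c ⬝ᵥ (Aᴴ * J).mulVec w := by
  rw [Matrix.star_mulVec, ← Matrix.dotProduct_mulVec, Matrix.mulVec_mulVec]

open scoped ComplexOrder in
lemma Matrix.forall_star_mulVec_dotProduct_eq_zero_iff {l m k : Type*} [Fintype l] [Fintype m]
    [Fintype k] (A : Matrix l m ℂ) (J : Matrix l k ℂ) (w : k → ℂ) :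
    (∀ c, star (A.mulVec c) ⬝ᵥ J.mulVec w = 0) ↔ w ∈ LinearMap.ker (Aᴴ * J).mulVecLin := by
  simp only [Matrix.star_mulVec_dotProduct_mulVec, LinearMap.mem_ker, Matrix.mulVecLin_apply]
  exact ⟨fun h => dotProduct_star_self_eq_zero.1 (h _),
    fun h c => by simp [h]⟩

/-- Non-degeneracy of the holomorphically extended Krein matrix: if `E = col M` and
`F = col N` give a holomorphic splitting of `ℂ^{2d}` over `Ω × S_δ` which is a
symplectic-orthogonal splitting at real points, then `F(z) = (E(z̄))^{⊥ω}` everywhere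
and the Krein matrix `G(z) = (1/i) M(z̄)* 𝒥_{2d} M(z)` is invertible everywhere. -/
theorem krein_matrix_nondegenerate
    (n d m : ℕ) (hm : 1 ≤ m) (hmd : m < d)
    (Ω : Set (Fin n → ℂ)) (hΩne : Ω.Nonempty) (hΩopen : IsOpen Ω)
    (hΩconn : IsConnected Ω) (hΩcontr : ContractibleSpace ↥Ω)
    (hΩconj : ∀ x ∈ Ω, star x ∈ Ω)
    (hΩreal : ∃ x ∈ Ω, ∀ i, (x i).im = 0)
    (δ : ℝ) (hδ : 0 < δ)
    (M : (Fin n → ℂ) → ℂ → Matrix (Fin (2 * d)) (Fin (2 * m)) ℂ)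
    (N : (Fin n → ℂ) → ℂ → Matrix (Fin (2 * d)) (Fin (2 * d - 2 * m)) ℂ)
    (hMhol : ∀ (i : Fin (2 * d)) (j : Fin (2 * m)),
      DifferentiableOn ℂ (fun p : (Fin n → ℂ) × ℂ => M p.1 p.2 i j) (Ω ×ˢ strip δ))
    (hNhol : ∀ (i : Fin (2 * d)) (j : Fin (2 * d - 2 * m)),
      DifferentiableOn ℂ (fun p : (Fin n → ℂ) × ℂ => N p.1 p.2 i j) (Ω ×ˢ strip δ))
    (hMper : ∀ x ∈ Ω, ∀ z ∈ strip δ, M x (z + 1) = M x z)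
    (hNper : ∀ x ∈ Ω, ∀ z ∈ strip δ, N x (z + 1) = N x z)
    (hMrank : ∀ x ∈ Ω, ∀ z ∈ strip δ, (M x z).rank = 2 * m)
    (hNrank : ∀ x ∈ Ω, ∀ z ∈ strip δ, (N x z).rank = 2 * d - 2 * m)
    (hsplit : ∀ x ∈ Ω, ∀ z ∈ strip δ,
      IsCompl (LinearMap.range (M x z).mulVecLin) (LinearMap.range (N x z).mulVecLin))
    (hrealorth : ∀ x ∈ Ω, (∀ i, (x i).im = 0) → ∀ t : ℝ,
      ∀ w : Fin (2 * d) → ℂ,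
        (w ∈ LinearMap.range (N x (t : ℂ)).mulVecLin ↔
          ∀ c : Fin (2 * m) → ℂ,
            star ((M x (t : ℂ)).mulVec c) ⬝ᵥ (Jmat d).mulVec w = 0)) :
    ∀ x ∈ Ω, ∀ z ∈ strip δ,
      (M (star x) (starRingEnd ℂ z))ᴴ * Jmat d * N x z = 0 ∧
      (∀ w : Fin (2 * d) → ℂ,
        (w ∈ LinearMap.range (N x z).mulVecLin ↔
          ∀ c : Fin (2 * m) → ℂ,
            star ((M (star x) (starRingEnd ℂ z)).mulVec c) ⬝ᵥ (Jmat d).mulVec w = 0)) ∧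
      IsUnit ((Complex.I)⁻¹ •
        ((M (star x) (starRingEnd ℂ z))ᴴ * Jmat d * M x z)) := by
  intro x hx z hz
  let U : Set ((Fin n → ℂ) × ℂ) := Ω ×ˢ strip δ
  have hUo : IsOpen U := hΩopen.prod (isOpen_strip δ)
  have hUc : IsPreconnected U := hΩconn.isPreconnected.prod (convex_strip δ).isPreconnected
  have hUstar : ∀ p ∈ U, star p ∈ U := fun p hp => ⟨hΩconj _ hp.1, star_mem_strip hp.2⟩
  let A : (Fin n → ℂ) × ℂ → Matrix (Fin (2 * m)) (Fin (2 * d)) ℂ :=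
    fun p => (M (star p.1) (star p.2))ᴴ * Jmat d
  have horth : A (x, z) * N x z = 0 := by
    ext a b
    have hdiff : DifferentiableOn ℂ (fun p => (A p * N p.1 p.2) a b) U := by
      simp only [A, Matrix.mul_apply, Matrix.conjTranspose_apply]
      refine DifferentiableOn.fun_sum fun i _ => DifferentiableOn.mul ?_ (hNhol i b)
      refine DifferentiableOn.fun_sum fun j _ => DifferentiableOn.mul_const ?_ _
      intro p hp
      have hM : DifferentiableAt ℂ (fun p : (Fin n → ℂ) × ℂ => M p.1 p.2 j a) (star p) :=
        (hMhol j a).differentiableAt (hUo.mem_nhds (hUstar p hp))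
      have := hM.star_star
      rw [star_star] at this
      exact this.differentiableWithinAt
    obtain ⟨x₀, hx₀, hx₀r⟩ := hΩreal
    have hx₀s : star x₀ = x₀ := funext fun i => Complex.conj_eq_iff_im.2 (hx₀r i)
    refine hdiff.eqOn_zero_of_isSelfAdjoint hUo hUc (p₀ := (x₀, 0)) ⟨hx₀, by simpa [strip]⟩
      (Prod.ext hx₀s (star_zero ℂ)) ?_ ⟨hx, hz⟩
    rintro ⟨y, t⟩ ⟨hy, -⟩ hsa
    have hys : star y = y := congrArg Prod.fst hsa
    have hts : star t = t := congrArg Prod.snd hsa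
    obtain ⟨t, rfl⟩ := Complex.conj_eq_iff_real.1 hts
    have hcol : (N y t).mulVec (Pi.single b 1) ∈
        LinearMap.ker ((M y t)ᴴ * Jmat d).mulVecLin :=
      (Matrix.forall_star_mulVec_dotProduct_eq_zero_iff _ _ _).1 <|
        (hrealorth y hy (fun i => Complex.conj_eq_iff_im.1 (congrFun hys i)) t _).1 ⟨_, rfl⟩
    have hab := congrFun (LinearMap.mem_ker.1 hcol) a
    rw [Matrix.mulVecLin_apply, Matrix.mulVec_mulVec, Matrix.mulVec_single_one] at hab
    simpa [A, hys] using hab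
  have hrankA : (A (x, z)).rank = 2 * m := by
    rw [Matrix.rank_mul_eq_left_of_isUnit_det _ _
      ((Matrix.isUnit_iff_isUnit_det _).1 (isUnit_Jmat d)), Matrix.rank_conjTranspose_eq]
    exact hMrank _ (hΩconj x hx) _ (star_mem_strip hz)
  have hker : LinearMap.range (N x z).mulVecLin = LinearMap.ker (A (x, z)).mulVecLin := by
    refine Matrix.range_mulVecLin_eq_ker_of_rank_add_rank horth ?_
    rw [hrankA, hNrank x hx z hz, Fintype.card_fin]
    omega
  refine ⟨horth, fun w => ?_, ?_⟩
  · rw [Matrix.forall_star_mulVec_dotProduct_eq_zero_iff, hker]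
    rfl
  · refine IsUnit.smul (Units.mk0 _ (inv_ne_zero Complex.I_ne_zero)) ?_
    refine Matrix.isUnit_mul_of_disjoint_range_ker (A := A (x, z)) ?_ ?_
    · rw [hMrank x hx z hz, Fintype.card_fin]
    · exact hker ▸ (hsplit x hx z hz).disjoint
end
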